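/- (Theorem 2, monotonic improvement) In the finite matrix MDP setup with initial distributions, suppose 0 < γ, ‖R‖_∞ ≤ Rmax, ‖Pπ - Pμ‖_op ≤ ε, ‖π₀ - μ₀‖₁ ≤ ε, and γ·ε < 1 - γ. Then for every K ≥ 1 the true objective is lower-bounded by the truncated generalized trust-region objective: J(π) ≥ J(μ) + ∑_{k=1}^{K} Lₖ - G_K, where J(π) = π₀ ⬝ᵥ Qπ, J(μ) = μ₀ ⬝ᵥ Qμ, and G_K = (1/(γ(1-γ))) · (1 - γ·ε/(1-γ))⁻¹ · (γ·ε/(1-γ))^(K+1) · Rmax. -/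

import Mathlib

open Matrix

/-- Sup norm of a vector. -/
noncomputable def vecSupNorm {S : Type*} [Fintype S] (v : S → ℝ) : ℝ := ⨆ s, |v s|

/-- Maximum row ℓ1-norm of a matrix. -/
noncomputable def matOpNorm {S : Type*} [Fintype S] (A : Matrix S S ℝ) : ℝ :=
  ⨆ s, ∑ t, |A s t|

theorem aux_bound {S : Type*} [Fintype S] [Nonempty S] [DecidableEq S]
    (γ : ℝ) (hγ0 : 0 ≤ γ) (hγ1 : γ < 1) (P : Matrix S S ℝ)
    (hP0 : ∀ s t, 0 ≤ P s t) (hP1 : ∀ s, ∑ t, P s t = 1) (v : S → ℝ) (c : ℝ)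
    (h : ∀ s, |((1 - γ • P) *ᵥ v) s| ≤ c) : ∀ s, |v s| ≤ c / (1 - γ) := by
  obtain ⟨m, hm⟩ := Finite.exists_max (fun s => |v s|)
  intro s
  refine (hm s).trans ?_
  rw [le_div_iff₀ (by linarith)]
  have h1 : v m = ((1 - γ • P) *ᵥ v) m + γ * (P *ᵥ v) m := by
    simp [Matrix.sub_mulVec, Matrix.smul_mulVec]
  have h2 : |(P *ᵥ v) m| ≤ |v m| := by
    calc |(P *ᵥ v) m| ≤ ∑ t, |P m t * v t| := Finset.abs_sum_le_sum_abs _ _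
      _ ≤ ∑ t, P m t * |v m| := by
          refine Finset.sum_le_sum fun t _ => ?_
          rw [abs_mul, abs_of_nonneg (hP0 m t)]
          exact mul_le_mul_of_nonneg_left (hm t) (hP0 m t)
      _ = |v m| := by rw [← Finset.sum_mul, hP1, one_mul]
  have h3 : |v m| ≤ c + γ * |v m| := by
    calc |v m| = |((1 - γ • P) *ᵥ v) m + γ * (P *ᵥ v) m| := by rw [← h1]
      _ ≤ |((1 - γ • P) *ᵥ v) m| + |γ * (P *ᵥ v) m| := abs_add_le _ _
      _ ≤ c + γ * |v m| := by
          rw [abs_mul, abs_of_nonneg hγ0]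
          exact add_le_add (h m) (mul_le_mul_of_nonneg_left h2 hγ0)
  linarith

theorem aux_inv {S : Type*} [Fintype S] [Nonempty S] [DecidableEq S]
    (γ : ℝ) (hγ0 : 0 ≤ γ) (hγ1 : γ < 1) (P : Matrix S S ℝ)
    (hP0 : ∀ s t, 0 ≤ P s t) (hP1 : ∀ s, ∑ t, P s t = 1) :
    (1 - γ • P) * (1 - γ • P)⁻¹ = 1 ∧ (1 - γ • P)⁻¹ * (1 - γ • P) = 1 := by
  have hu : IsUnit (1 - γ • P) := by
    rw [← Matrix.mulVec_injective_iff_isUnit]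
    intro v w hvw
    have := aux_bound γ hγ0 hγ1 P hP0 hP1 (v - w) 0 (by
      intro s
      have hvw' : (1 - γ • P) *ᵥ v = (1 - γ • P) *ᵥ w := hvw
      rw [Matrix.mulVec_sub, hvw']; simp)
    ext s
    have h := this s
    rw [zero_div] at h
    have := abs_nonpos_iff.mp h
    exact sub_eq_zero.mp this
  have hd := (Matrix.isUnit_iff_isUnit_det _).mp hu
  exact ⟨Matrix.mul_nonsing_inv _ hd, Matrix.nonsing_inv_mul _ hd⟩

theorem aux_dot {S : Type*} [Fintype S] (a v : S → ℝ) (c d : ℝ) (hc : 0 ≤ c)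
    (ha : ∑ s, |a s| ≤ d) (hv : ∀ s, |v s| ≤ c) : |a ⬝ᵥ v| ≤ d * c := by
  calc |a ⬝ᵥ v| ≤ ∑ s, |a s * v s| := Finset.abs_sum_le_sum_abs _ _
    _ ≤ ∑ s, |a s| * c := by
        refine Finset.sum_le_sum fun t _ => ?_
        rw [abs_mul]
        exact mul_le_mul_of_nonneg_left (hv t) (abs_nonneg _)
    _ ≤ d * c := by rw [← Finset.sum_mul]; exact mul_le_mul_of_nonneg_right ha hc

/-- **Theorem 2 (monotonic improvement).**
Under `0 < γ`, `‖R‖_∞ ≤ Rmax`, `‖Pπ - Pμ‖_op ≤ ε`, `‖π₀ - μ₀‖₁ ≤ ε`, `γ·ε < 1 - γ`,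
for every `K ≥ 1`: `J(π) ≥ J(μ) + ∑_{k=1}^{K} Lₖ - G_K`. -/
theorem stmt_12 {S : Type*} [Fintype S] [Nonempty S] [DecidableEq S]
    (γ : ℝ) (hγ0 : 0 ≤ γ) (hγ1 : γ < 1) (hγpos : 0 < γ)
    (Pπ Pμ : Matrix S S ℝ)
    (hPπ0 : ∀ s t, 0 ≤ Pπ s t) (hPπ1 : ∀ s, ∑ t, Pπ s t = 1)
    (hPμ0 : ∀ s t, 0 ≤ Pμ s t) (hPμ1 : ∀ s, ∑ t, Pμ s t = 1)
    (R : S → ℝ) (Qπ Qμ : S → ℝ)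
    (hQπ : Qπ = (1 - γ • Pπ)⁻¹ *ᵥ R) (hQμ : Qμ = (1 - γ • Pμ)⁻¹ *ᵥ R)
    (M : Matrix S S ℝ) (hM : M = γ • ((1 - γ • Pμ)⁻¹ * (Pπ - Pμ)))
    (π₀ μ₀ : S → ℝ)
    (hπ₀0 : ∀ s, 0 ≤ π₀ s) (hπ₀1 : ∑ s, π₀ s = 1)
    (hμ₀0 : ∀ s, 0 ≤ μ₀ s) (hμ₀1 : ∑ s, μ₀ s = 1)
    (L : ℕ → ℝ)
    (hL1 : L 1 = (π₀ - μ₀) ⬝ᵥ Qμ + μ₀ ⬝ᵥ ((M ^ 1) *ᵥ Qμ))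
    (hLk : ∀ k : ℕ, 2 ≤ k →
      L k = (π₀ - μ₀) ⬝ᵥ ((M ^ (k - 1)) *ᵥ Qμ) + μ₀ ⬝ᵥ ((M ^ k) *ᵥ Qμ))
    (Rmax ε : ℝ) (hR : vecSupNorm R ≤ Rmax) (hε : matOpNorm (Pπ - Pμ) ≤ ε)
    (hinit : ∑ s, |π₀ s - μ₀ s| ≤ ε)
    (hsmall : γ * ε < 1 - γ) :
    ∀ K : ℕ, 1 ≤ K →
      π₀ ⬝ᵥ Qπ ≥
        μ₀ ⬝ᵥ Qμ + (∑ k ∈ Finset.Icc 1 K, L k) -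
          (1 / (γ * (1 - γ))) * (1 - γ * ε / (1 - γ))⁻¹ * (γ * ε / (1 - γ)) ^ (K + 1) * Rmax := by
  obtain ⟨s0⟩ := ‹Nonempty S›
  haveI : Nonempty S := ⟨s0⟩
  obtain ⟨hA1, hA2⟩ := aux_inv γ hγ0 hγ1 Pμ hPμ0 hPμ1
  obtain ⟨hB1, hB2⟩ := aux_inv γ hγ0 hγ1 Pπ hPπ0 hPπ1
  have hg : 0 < 1 - γ := by linarith
  have hRs : ∀ s, |R s| ≤ Rmax := fun s =>
    (le_ciSup (f := fun s => |R s|) (Set.finite_range _).bddAbove s).trans hR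
  have hDs : ∀ s, ∑ t, |(Pπ - Pμ) s t| ≤ ε := fun s =>
    (le_ciSup (f := fun s => ∑ t, |(Pπ - Pμ) s t|) (Set.finite_range _).bddAbove s).trans hε
  have hR0 : 0 ≤ Rmax := (abs_nonneg _).trans (hRs s0)
  have hε0 : 0 ≤ ε := (Finset.sum_nonneg fun _ _ => abs_nonneg _).trans hinit
  have hRQ : (1 - γ • Pπ) *ᵥ Qπ = R := by
    rw [hQπ, Matrix.mulVec_mulVec, hB1, Matrix.one_mulVec]
  have hQb : ∀ s, |Qπ s| ≤ Rmax / (1 - γ) :=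
    aux_bound γ hγ0 hγ1 Pπ hPπ0 hPπ1 Qπ Rmax (by rw [hRQ]; exact hRs)
  have hrec : Qπ = Qμ + M *ᵥ Qπ := by
    have h1 : R = (1 - γ • Pμ) *ᵥ Qπ - (γ • (Pπ - Pμ)) *ᵥ Qπ := by
      rw [← Matrix.sub_mulVec, ← hRQ]
      congr 1
      rw [smul_sub]; abel
    have h2 : Qμ = Qπ - M *ᵥ Qπ := by
      rw [hQμ, h1, Matrix.mulVec_sub, Matrix.mulVec_mulVec, Matrix.mulVec_mulVec, hA2,
        Matrix.one_mulVec, hM, Matrix.mul_smul]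
    rw [h2]; abel
  set x := γ * ε / (1 - γ) with hx
  have hx0 : 0 ≤ x := by positivity
  have hx1 : x < 1 := by rw [hx, div_lt_one hg]; exact hsmall
  have hMb : ∀ k s, |((M ^ k) *ᵥ Qπ) s| ≤ x ^ k * (Rmax / (1 - γ)) := by
    intro k
    induction k with
    | zero => simpa using hQb
    | succ k ih =>
      intro s
      have e : (1 - γ • Pμ) *ᵥ ((M ^ (k + 1)) *ᵥ Qπ) =
          γ • ((Pπ - Pμ) *ᵥ ((M ^ k) *ᵥ Qπ)) := by
        have e1 : (1 - γ • Pμ) * M = γ • (Pπ - Pμ) := by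
          rw [hM, Matrix.mul_smul, ← Matrix.mul_assoc, hA1, Matrix.one_mul]
        rw [pow_succ', Matrix.mulVec_mulVec, ← Matrix.mul_assoc, e1, ← Matrix.mulVec_mulVec,
          Matrix.smul_mulVec]
      have := aux_bound γ hγ0 hγ1 Pμ hPμ0 hPμ1 ((M ^ (k + 1)) *ᵥ Qπ)
        (γ * (ε * (x ^ k * (Rmax / (1 - γ))))) (by
          intro s
          rw [e, Pi.smul_apply, smul_eq_mul, abs_mul, abs_of_nonneg hγ0]
          exact mul_le_mul_of_nonneg_left
            (aux_dot _ _ _ _ (by positivity) (hDs s) ih) hγ0) s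
      refine this.trans (le_of_eq ?_)
      rw [pow_succ, hx]; ring
  have hstep : ∀ k, (M ^ k) *ᵥ Qπ = (M ^ k) *ᵥ Qμ + (M ^ (k + 1)) *ᵥ Qπ := by
    intro k
    conv_lhs => rw [hrec]
    rw [Matrix.mulVec_add, Matrix.mulVec_mulVec, pow_succ]
  have hLall : ∀ k, L (k + 1) = (π₀ - μ₀) ⬝ᵥ ((M ^ k) *ᵥ Qμ) + μ₀ ⬝ᵥ ((M ^ (k + 1)) *ᵥ Qμ) := by
    intro k
    rcases Nat.eq_zero_or_pos k with rfl | hk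
    · rw [hL1]; simp
    · rw [hLk (k + 1) (by omega)]; simp
  have hmain : ∀ K, π₀ ⬝ᵥ Qπ = μ₀ ⬝ᵥ Qμ + (∑ k ∈ Finset.Icc 1 K, L k) +
      ((π₀ - μ₀) ⬝ᵥ ((M ^ K) *ᵥ Qπ) + μ₀ ⬝ᵥ ((M ^ (K + 1)) *ᵥ Qπ)) := by
    intro K
    induction K with
    | zero =>
      have h := congrArg (fun v => μ₀ ⬝ᵥ v) hrec
      simp only [dotProduct_add] at h
      simp [sub_dotProduct]
      linarith
    | succ K ih =>
      rw [Finset.sum_Icc_succ_top (by omega), hLall, ih]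
      have h1 := congrArg (fun v => (π₀ - μ₀) ⬝ᵥ v) (hstep K)
      have h2 := congrArg (fun v => μ₀ ⬝ᵥ v) (hstep (K + 1))
      simp only [dotProduct_add] at h1 h2
      linarith
  intro K _
  rw [hmain K]
  have b1 := aux_dot (π₀ - μ₀) _ _ ε (by positivity) hinit (hMb K)
  have b2 := aux_dot μ₀ _ _ 1 (by positivity)
    (by simp_rw [abs_of_nonneg (hμ₀0 _)]; exact hμ₀1.le) (hMb (K + 1))
  have hb : ε * (x ^ K * (Rmax / (1 - γ))) + 1 * (x ^ (K + 1) * (Rmax / (1 - γ)))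
      = 1 / (γ * (1 - γ)) * x ^ (K + 1) * Rmax := by
    have hex : ε = x * (1 - γ) / γ := by rw [hx]; field_simp
    rw [pow_succ]
    generalize x ^ K = y
    clear_value x
    rw [hex]
    field_simp
    ring
  have hc : 1 / (γ * (1 - γ)) * x ^ (K + 1) * Rmax ≤
      1 / (γ * (1 - γ)) * (1 - x)⁻¹ * x ^ (K + 1) * Rmax := by
    have h1 : 1 ≤ (1 - x)⁻¹ := (one_le_inv₀ (by linarith)).mpr (by linarith)
    have h2 : 0 ≤ 1 / (γ * (1 - γ)) * x ^ (K + 1) * Rmax := by positivity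
    nlinarith [mul_le_mul_of_nonneg_right h1 h2]
  have a1 := (abs_le.mp b1).1
  have a2 := (abs_le.mp b2).1
  linarith
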